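/- arXiv:2506.19778 — 8 statements merged into one kernel-verified Lean document; each statement's English description precedes it below -/
import Mathlib

section
/- Let m ≥ 1 and let P₁, …, P_m be complex N×N Hermitian matrices such that P_k² = I, trace(P_k) = 0 for every k, and P_j P_k = −P_k P_j for all j ≠ k. Let β₁, …, β_m be real numbers with Σ_{k=1}^m β_k² = 1. Then there exists a unitary N×N matrix U such that U* (Σ_{k=1}^m β_k P_k) U = P₁. (An l2-normalized real linear combination of pairwise anticommuting Pauli operators is unitarily equivalent to a single Pauli operator.) -/
open Matrix BigOperators

/-- Real numbers that all square to `1` and sum to zero can be permuted into their negatives. -/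
theorem exists_perm_eq_neg_of_sum_eq_zero {ι : Type*} [Fintype ι] (d : ι → ℝ)
    (hd : ∀ i, d i * d i = 1) (hsum : ∑ i, d i = 0) :
    ∃ σ : Equiv.Perm ι, ∀ i, d (σ i) = -d i := by
  classical
  have hd' : ∀ i, d i = 1 ∨ d i = -1 := fun i => mul_self_eq_one_iff.mp (hd i)
  have hcard : Fintype.card {i // d i = 1} = Fintype.card {i // ¬ d i = 1} := by
    have hval : ∀ i, d i = (if d i = 1 then 1 else 0) - (if ¬ d i = 1 then 1 else 0) := by
      intro i
      rcases hd' i with h | h <;> rw [h] <;> norm_num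
    rw [Finset.sum_congr rfl fun i _ => hval i, Finset.sum_sub_distrib, Finset.sum_boole,
      Finset.sum_boole, sub_eq_zero] at hsum
    rw [Fintype.card_subtype, Fintype.card_subtype]
    exact_mod_cast hsum
  let e := Fintype.equivOfCardEq hcard
  refine ⟨(Equiv.sumCompl fun i => d i = 1).symm.trans
    ((Equiv.sumComm _ _).trans ((Equiv.sumCongr e.symm e).trans
      (Equiv.sumCompl fun i => d i = 1))), fun i => ?_⟩
  by_cases h : d i = 1
  · have := (hd' (e ⟨i, h⟩)).resolve_left (e ⟨i, h⟩).2
    simp [h, this]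
  · have h' := (hd' i).resolve_left h
    have := (e.symm ⟨i, h⟩).2
    rw [Equiv.trans_apply, Equiv.sumCompl_symm_apply_of_neg (p := fun i => d i = 1) h]
    simp [h', this]

/-- A traceless Hermitian involution is unitarily equivalent to its negative. -/
theorem Matrix.IsHermitian.exists_unitary_conj_neg {n : Type*} [Fintype n] [DecidableEq n]
    {A : Matrix n n ℂ} (hA : A.IsHermitian) (hsq : A * A = 1) (htr : A.trace = 0) :
    ∃ U ∈ Matrix.unitaryGroup n ℂ, Uᴴ * (-A) * U = A := by
  set V : Matrix n n ℂ := hA.eigenvectorUnitary.1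
  set D : Matrix n n ℂ := diagonal (fun i => (hA.eigenvalues i : ℂ)) with hD
  have hVV : Vᴴ * V = 1 := mem_unitaryGroup_iff'.mp hA.eigenvectorUnitary.2
  have hVV' : V * Vᴴ = 1 := mem_unitaryGroup_iff.mp hA.eigenvectorUnitary.2
  have hspec : A = V * D * Vᴴ := by
    have := hA.spectral_theorem
    rwa [Unitary.conjStarAlgAut_apply] at this
  have hDD : D * D = 1 := by
    have : D = Vᴴ * A * V := by
      rw [hspec]
      simp only [Matrix.mul_assoc, hVV, Matrix.mul_one]
      rw [← Matrix.mul_assoc, hVV, Matrix.one_mul]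
    rw [this]
    calc Vᴴ * A * V * (Vᴴ * A * V) = Vᴴ * A * (V * Vᴴ) * A * V := by
          simp only [Matrix.mul_assoc]
      _ = Vᴴ * (A * A) * V := by rw [hVV', Matrix.mul_one, Matrix.mul_assoc Vᴴ A A]
      _ = 1 := by rw [hsq, Matrix.mul_one, hVV]
  have heig : ∀ i, hA.eigenvalues i * hA.eigenvalues i = 1 := by
    intro i
    have := congrFun (congrFun hDD i) i
    rw [hD, diagonal_mul_diagonal, diagonal_apply_eq, one_apply_eq] at this
    exact_mod_cast this
  have hsum : ∑ i, hA.eigenvalues i = 0 := by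
    have : (0 : ℂ) = ∑ i, (hA.eigenvalues i : ℂ) := htr ▸ hA.trace_eq_sum_eigenvalues
    exact_mod_cast this.symm
  obtain ⟨σ, hσ⟩ := exists_perm_eq_neg_of_sum_eq_zero hA.eigenvalues heig hsum
  set S : Matrix n n ℂ := (1 : Matrix n n ℂ).submatrix id σ with hS
  have hSS : Sᴴ * S = 1 := by
    ext i j
    simp [hS, Matrix.mul_apply, Matrix.one_apply]
  have hSD : Sᴴ * (-D) * S = D := by
    ext i j
    simp [hS, hD, Matrix.mul_apply, Matrix.one_apply, diagonal_apply, hσ]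
    split_ifs with h <;> simp [h]
  refine ⟨V * S * Vᴴ, mem_unitaryGroup_iff'.mpr ?_, ?_⟩
  · rw [star_eq_conjTranspose]
    simp only [conjTranspose_mul, conjTranspose_conjTranspose]
    calc V * (Sᴴ * Vᴴ) * (V * S * Vᴴ) = V * Sᴴ * (Vᴴ * V) * S * Vᴴ := by
          simp only [Matrix.mul_assoc]
      _ = V * (Sᴴ * S) * Vᴴ := by rw [hVV, Matrix.mul_one, Matrix.mul_assoc V]
      _ = 1 := by rw [hSS, Matrix.mul_one, hVV']
  · simp only [conjTranspose_mul, conjTranspose_conjTranspose]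
    calc V * (Sᴴ * Vᴴ) * (-A) * (V * S * Vᴴ)
        = V * Sᴴ * (Vᴴ * V) * (-D) * (Vᴴ * V) * S * Vᴴ := by
          rw [hspec]
          simp only [Matrix.mul_assoc, Matrix.mul_neg, Matrix.neg_mul]
      _ = V * (Sᴴ * (-D) * S) * Vᴴ := by
          simp only [hVV, Matrix.mul_one, Matrix.mul_assoc]
      _ = A := by rw [hSD, ← hspec]

open scoped ComplexOrder in
/-- Two Hermitian involutions whose anticommutator is a scalar `2 * b` with `-1 ≤ b` are
unitarily equivalent, provided that one of them is traceless. -/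
theorem Matrix.IsHermitian.exists_unitary_conj_eq {n : Type*} [Fintype n] [DecidableEq n]
    {A B : Matrix n n ℂ} (hA : A.IsHermitian) (hB : B.IsHermitian) (hAA : A * A = 1)
    (hBB : B * B = 1) (htr : B.trace = 0) {b : ℝ} (hb : -1 ≤ b)
    (hAB : A * B + B * A = ((2 * b : ℝ) : ℂ) • (1 : Matrix n n ℂ)) :
    ∃ U ∈ Matrix.unitaryGroup n ℂ, Uᴴ * A * U = B := by
  have hW : (A + B)ᴴ = A + B := hA.add hB
  have hWW : (A + B) * (A + B) = ((2 + 2 * b : ℝ) : ℂ) • (1 : Matrix n n ℂ) := by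
    calc (A + B) * (A + B) = A * A + B * B + (A * B + B * A) := by noncomm_ring
      _ = _ := by
        rw [hAA, hBB, hAB]
        push_cast
        module
  rcases hb.eq_or_lt with rfl | hb
  · have : A + B = 0 := by
      rw [← conjTranspose_mul_self_eq_zero, hW, hWW]
      norm_num
    rw [eq_neg_of_add_eq_zero_left this]
    exact hB.exists_unitary_conj_neg hBB htr
  · have hc : 0 < 2 + 2 * b := by linarith
    set r : ℝ := (√(2 + 2 * b))⁻¹ with hr
    have hrr : (r : ℂ) * r * ((2 + 2 * b : ℝ) : ℂ) = 1 := by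
      have : r * r * (2 + 2 * b) = 1 := by
        rw [hr, ← mul_inv, Real.mul_self_sqrt hc.le, inv_mul_cancel₀ hc.ne']
      exact_mod_cast this
    have hU : ((r : ℂ) • (A + B))ᴴ = (r : ℂ) • (A + B) := by
      rw [conjTranspose_smul, hW]
      simp
    have hUU : ((r : ℂ) • (A + B)) * ((r : ℂ) • (A + B)) = 1 := by
      rw [smul_mul_smul_comm, hWW, smul_smul, hrr, one_smul]
    refine ⟨(r : ℂ) • (A + B), mem_unitaryGroup_iff.mpr ?_, ?_⟩
    · rw [star_eq_conjTranspose, hU, hUU]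
    · have hcomm : A * ((r : ℂ) • (A + B)) = ((r : ℂ) • (A + B)) * B := by
        rw [mul_smul_comm, smul_mul_assoc, mul_add, add_mul, hAA, hBB, add_comm]
      rw [hU, Matrix.mul_assoc, hcomm, ← Matrix.mul_assoc, hUU, Matrix.one_mul]

/-- The anticommutator of two linear combinations of pairwise anticommuting involutions. -/
theorem anticommutator_sum_smul {ι n : Type*} [Fintype ι] [Fintype n] [DecidableEq n]
    {P : ι → Matrix n n ℂ} (hsq : ∀ k, P k * P k = 1)
    (hanti : ∀ j k, j ≠ k → P j * P k = -(P k * P j)) (a b : ι → ℂ) :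
    (∑ j, a j • P j) * (∑ k, b k • P k) + (∑ k, b k • P k) * (∑ j, a j • P j) =
      (2 * ∑ k, a k * b k) • (1 : Matrix n n ℂ) := by
  classical
  have hpair : ∀ j k, P j * P k + P k * P j =
      if j = k then (2 : ℂ) • (1 : Matrix n n ℂ) else 0 := by
    intro j k
    split_ifs with h
    · rw [h, hsq, two_smul]
    · rw [hanti j k h, neg_add_cancel]
  calc _ = ∑ j, ∑ k, (a j * b k) • (P j * P k + P k * P j) := by
        rw [Finset.sum_mul_sum, Finset.sum_mul_sum,
          Finset.sum_comm (f := fun k j => b k • P k * a j • P j), ← Finset.sum_add_distrib]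
        refine Finset.sum_congr rfl fun j _ => ?_
        rw [← Finset.sum_add_distrib]
        refine Finset.sum_congr rfl fun k _ => ?_
        rw [smul_mul_smul_comm, smul_mul_smul_comm, smul_add, mul_comm (b k)]
    _ = _ := by
        simp only [hpair, smul_ite, smul_zero, Finset.sum_ite_eq, Finset.mem_univ, if_true,
          smul_smul]
        rw [← Finset.sum_smul, ← Finset.sum_mul, mul_comm]

/-- An `l2`-normalized real linear combination of pairwise anticommuting Hermitian
traceless involutions (abstract Pauli operators) is unitarily equivalent to a
single one of them. -/
theorem anticommuting_combination_unitarily_equivalent {N m : ℕ} (hm : 1 ≤ m)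
    (P : Fin m → Matrix (Fin N) (Fin N) ℂ)
    (hherm : ∀ k, (P k).IsHermitian)
    (hsq : ∀ k, P k * P k = 1)
    (htr : ∀ k, (P k).trace = 0)
    (hanti : ∀ j k, j ≠ k → P j * P k = -(P k * P j))
    (β : Fin m → ℝ) (hβ : ∑ k, (β k) ^ 2 = 1) :
    ∃ U ∈ Matrix.unitaryGroup (Fin N) ℂ,
      Uᴴ * (∑ k, (β k : ℂ) • P k) * U = P ⟨0, hm⟩ := by
  have hA : (∑ k, (β k : ℂ) • P k).IsHermitian := by
    rw [Matrix.IsHermitian, conjTranspose_sum]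
    refine Finset.sum_congr rfl fun k _ => ?_
    rw [conjTranspose_smul, hherm k]
    simp
  have hAA : (∑ k, (β k : ℂ) • P k) * (∑ k, (β k : ℂ) • P k) = 1 := by
    have h := anticommutator_sum_smul hsq hanti (fun k => (β k : ℂ)) (fun k => (β k : ℂ))
    have hβ' : ∑ k, (β k : ℂ) * β k = 1 := by
      simp only [← sq]
      exact_mod_cast hβ
    rw [hβ', ← two_smul ℂ, mul_one] at h
    exact smul_right_injective _ two_ne_zero h
  have hb : -1 ≤ β ⟨0, hm⟩ := by
    have := Finset.single_le_sum (fun k _ => sq_nonneg (β k)) (Finset.mem_univ ⟨0, hm⟩)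
    exact (abs_le.mp (abs_le_one_iff_mul_self_le_one.mpr (by nlinarith))).1
  refine hA.exists_unitary_conj_eq (hherm _) hAA (hsq _) (htr _) hb ?_
  have h := anticommutator_sum_smul hsq hanti (fun k => (β k : ℂ)) (Pi.single ⟨0, hm⟩ 1)
  simpa [Pi.single_apply, ite_smul] using h
end

section
/- Let m ≥ 1 and let P₀, P₁, …, P_m be complex N×N Hermitian matrices such that P_k² = I for every k and P_j P_k = −P_k P_j for all j ≠ k. Let β₀, β₁, …, β_m be real numbers with Σ_{k=0}^m β_k² = 1. Then there exist real numbers d₀, d₁, …, d_m such that the matrix R := d₀·I + Σ_{k=1}^m d_k·(P_k P₀) is unitary and satisfies R* (Σ_{k=0}^m β_k P_k) R = P₀. (The unitary-partitioning rotation can be taken to be a real linear combination of the identity and the m products P_k P₀.) -/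
open Matrix BigOperators

/-- Real linear combinations of pairwise anticommuting involutions satisfy the Clifford relation. -/
lemma anticommutator_linear_combination {ι A : Type*} [Fintype ι] [Ring A] [Algebra ℂ A]
    (P : ι → A) (hsq : ∀ k, P k * P k = 1)
    (hanti : ∀ j k, j ≠ k → P j * P k = -(P k * P j)) (x y : ι → ℝ) :
    (∑ k, (x k : ℂ) • P k) * (∑ k, (y k : ℂ) • P k)
        + (∑ k, (y k : ℂ) • P k) * (∑ k, (x k : ℂ) • P k)
      = ((2 * ∑ k, x k * y k : ℝ) : ℂ) • (1 : A) := by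
  classical
  have hpair : ∀ j k, P j * P k + P k * P j = if j = k then (2 : ℂ) • (1 : A) else 0 := by
    intro j k
    split_ifs with h
    · rw [h, hsq, two_smul]
    · rw [hanti j k h, neg_add_cancel]
  have hswap : (∑ k, (y k : ℂ) • P k) * (∑ k, (x k : ℂ) • P k)
      = ∑ j, ∑ k, ((x j : ℂ) * y k) • (P k * P j) := by
    rw [Finset.sum_mul_sum, Finset.sum_comm]
    simp only [smul_mul_smul_comm, mul_comm]
  rw [hswap, Finset.sum_mul_sum]
  simp only [smul_mul_smul_comm, ← Finset.sum_add_distrib, ← smul_add, hpair, smul_ite,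
    smul_zero, Finset.sum_ite_eq, Finset.mem_univ, if_true, smul_smul]
  rw [← Finset.sum_smul, ← Finset.sum_mul]
  push_cast
  rw [mul_comm]

/-- A unit vector `d` along the bisector of the unit vector `β` and the first basis vector. -/
lemma exists_unit_bisector {m : ℕ} (hm : 1 ≤ m) (β : Fin (m + 1) → ℝ)
    (hβ : ∑ k, (β k) ^ 2 = 1) :
    ∃ d : Fin (m + 1) → ℝ, ∑ k, d k * d k = 1 ∧
      ∀ k, 2 * (∑ j, d j * β j) * d k - β k = if k = 0 then 1 else 0 := by
  rw [Fin.sum_univ_succ] at hβ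
  have hnonneg : 0 ≤ ∑ k : Fin m, (β k.succ) ^ 2 := Finset.sum_nonneg fun _ _ => sq_nonneg _
  by_cases h : β 0 = -1
  · have hzero : ∀ k : Fin m, β k.succ = 0 := by
      have hsum : ∑ k : Fin m, (β k.succ) ^ 2 = 0 := by rw [h] at hβ; linarith
      intro k
      exact pow_eq_zero_iff two_ne_zero |>.1
        ((Finset.sum_eq_zero_iff_of_nonneg fun _ _ => sq_nonneg _).1 hsum k (Finset.mem_univ k))
    let i : Fin m := ⟨0, hm⟩
    refine ⟨Pi.single i.succ 1, by simp [Pi.single_apply], fun k => ?_⟩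
    refine Fin.cases ?_ (fun k => ?_) k <;> simp [Pi.single_apply, hzero, h]
  · have hpos : 0 < (1 + β 0) / 2 := by
      have : -1 ≤ β 0 := by nlinarith
      have := lt_of_le_of_ne this (Ne.symm h)
      linarith
    obtain ⟨c, hc, hc2⟩ : ∃ c : ℝ, 0 < c ∧ c ^ 2 = (1 + β 0) / 2 :=
      ⟨√((1 + β 0) / 2), Real.sqrt_pos.2 hpos, Real.sq_sqrt hpos.le⟩
    have hβ0 : β 0 = 2 * c ^ 2 - 1 := by linarith
    have hrest : ∑ k : Fin m, (β k.succ) ^ 2 = 4 * c ^ 2 - 4 * c ^ 4 := by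
      rw [hβ0] at hβ; linear_combination hβ
    have hdot : c * β 0 + ∑ k : Fin m, β k.succ / (2 * c) * β k.succ = c := by
      have : ∑ k : Fin m, β k.succ / (2 * c) * β k.succ
          = (∑ k : Fin m, (β k.succ) ^ 2) / (2 * c) := by
        rw [Finset.sum_div]
        exact Finset.sum_congr rfl fun k _ => by ring
      rw [this, hrest, hβ0]
      field_simp
      ring
    have hnorm : ∑ k : Fin m, β k.succ / (2 * c) * (β k.succ / (2 * c)) = 1 - c ^ 2 := by
      have : ∑ k : Fin m, β k.succ / (2 * c) * (β k.succ / (2 * c))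
          = (∑ k : Fin m, (β k.succ) ^ 2) / (4 * c ^ 2) := by
        rw [Finset.sum_div]
        exact Finset.sum_congr rfl fun k _ => by ring
      rw [this, hrest]
      field_simp
    refine ⟨Fin.cons c fun k => β k.succ / (2 * c), ?_, fun k => ?_⟩
    · simp only [Fin.sum_univ_succ, Fin.cons_zero, Fin.cons_succ, hnorm]
      ring
    · simp only [Fin.sum_univ_succ, Fin.cons_zero, Fin.cons_succ, hdot]
      refine Fin.cases ?_ (fun k => ?_) k
      · simp only [Fin.cons_zero, if_true, hβ0]
        ring
      · simp only [Fin.cons_succ, Fin.succ_ne_zero, if_false]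
        field_simp
        ring

/-- The unitary-partitioning rotation mapping a normalized real linear combination
of pairwise anticommuting Hermitian involutions `P₀, …, P_m` onto `P₀` can be taken
to be a real linear combination of the identity and the `m` products `P_k * P₀`. -/
theorem unitary_partitioning_LCU_form {N m : ℕ} (hm : 1 ≤ m)
    (P : Fin (m + 1) → Matrix (Fin N) (Fin N) ℂ)
    (hherm : ∀ k, (P k).IsHermitian)
    (hsq : ∀ k, P k * P k = 1)
    (hanti : ∀ j k, j ≠ k → P j * P k = -(P k * P j))
    (β : Fin (m + 1) → ℝ) (hβ : ∑ k, (β k) ^ 2 = 1) :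
    ∃ d : Fin (m + 1) → ℝ,
      (d 0 : ℂ) • (1 : Matrix (Fin N) (Fin N) ℂ)
          + ∑ k : Fin m, (d k.succ : ℂ) • (P k.succ * P 0) ∈ Matrix.unitaryGroup (Fin N) ℂ ∧
      ((d 0 : ℂ) • (1 : Matrix (Fin N) (Fin N) ℂ)
          + ∑ k : Fin m, (d k.succ : ℂ) • (P k.succ * P 0))ᴴ
        * (∑ k, (β k : ℂ) • P k)
        * ((d 0 : ℂ) • (1 : Matrix (Fin N) (Fin N) ℂ)
          + ∑ k : Fin m, (d k.succ : ℂ) • (P k.succ * P 0)) = P 0 := by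
  obtain ⟨d, hd, hdβ⟩ := exists_unit_bisector hm β hβ
  have hR : (d 0 : ℂ) • (1 : Matrix (Fin N) (Fin N) ℂ)
      + ∑ k : Fin m, (d k.succ : ℂ) • (P k.succ * P 0) = (∑ k, (d k : ℂ) • P k) * P 0 := by
    rw [Fin.sum_univ_succ, add_mul, smul_mul_assoc, hsq, Finset.sum_mul]
    simp only [smul_mul_assoc]
  refine ⟨d, ?_⟩
  rw [hR]
  have hA : (∑ k, (d k : ℂ) • P k)ᴴ = ∑ k, (d k : ℂ) • P k := by
    simp [Matrix.conjTranspose_sum, Matrix.conjTranspose_smul, (hherm _).eq]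
  have hdd := anticommutator_linear_combination P hsq hanti d d
  have hdb := anticommutator_linear_combination P hsq hanti d β
  have hbis : ((2 * ∑ k, d k * β k : ℝ) : ℂ) • (∑ k, (d k : ℂ) • P k)
      - ∑ k, (β k : ℂ) • P k = P 0 := by
    rw [Finset.smul_sum, ← Finset.sum_sub_distrib]
    simp only [smul_smul, ← sub_smul, ← Complex.ofReal_mul, ← Complex.ofReal_sub, hdβ]
    simp
  set A := ∑ k, (d k : ℂ) • P k
  set H := ∑ k, (β k : ℂ) • P k
  have hAA : A * A = 1 := by
    rw [hd, ← two_smul ℂ (A * A)] at hdd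
    refine smul_right_injective _ (two_ne_zero : (2 : ℂ) ≠ 0) ?_
    simpa using hdd
  have hAHA : A * H * A = P 0 := by
    rw [eq_sub_of_add_eq hdb, sub_mul, mul_assoc, hAA, smul_mul_assoc, one_mul, mul_one, hbis]
  rw [Matrix.conjTranspose_mul, hA, (hherm 0).eq]
  constructor
  · rw [Matrix.mem_unitaryGroup_iff, Matrix.star_eq_conjTranspose, Matrix.conjTranspose_mul, hA,
      (hherm 0).eq, mul_assoc, ← mul_assoc (P 0), hsq, one_mul, hAA]
  · calc P 0 * A * H * (A * P 0) = P 0 * (A * H * A) * P 0 := by simp only [mul_assoc]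
      _ = P 0 := by rw [hAHA, hsq, one_mul]
end

section
/- Let n ≥ 1, N = 2^n, and let P₁, …, P_m be complex N×N Hermitian matrices such that P_k² = I, trace(P_k) = 0 for every k, and P_j P_k = −P_k P_j for all j ≠ k. Let c = (c₁, …, c_m) be a nonzero real vector and D := Σ_{k=1}^m c_k P_k. Then each of the two eigenspaces ker(D − ‖c‖₂·I) and ker(D + ‖c‖₂·I) has complex dimension 2^{n−1}; i.e., each of the two eigenvalues ±‖c‖₂ occurs with multiplicity 2^{n−1}, so the eigenspace splits equally into a positive and a negative subspace. -/
open Matrix BigOperators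

/-- The square of a linear combination of pairwise anticommuting involutions is scalar. -/
theorem sum_smul_mul_self_of_anticommute {ι K A : Type*} [Fintype ι] [Field K] [NeZero (2 : K)]
    [Ring A] [Algebra K A] (P : ι → A) (hsq : ∀ k, P k * P k = 1)
    (hanti : ∀ j k, j ≠ k → P j * P k = -(P k * P j)) (c : ι → K) :
    (∑ k, c k • P k) * (∑ k, c k • P k) = (∑ k, c k ^ 2) • (1 : A) := by
  classical
  have expand : (∑ k, c k • P k) * (∑ k, c k • P k) =
      ∑ j, ∑ k, (c j * c k) • (P j * P k) := by
    simp only [Finset.sum_mul_sum, smul_mul_smul_comm]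
  have diag (j k : ι) : (c j * c k) • (P j * P k) + (c k * c j) • (P k * P j) =
      if j = k then (2 * c j ^ 2) • (1 : A) else 0 := by
    split_ifs with h
    · subst h
      rw [hsq, ← add_smul]
      ring_nf
    · rw [hanti j k h, mul_comm (c k), smul_neg, neg_add_cancel]
  have double : (2 : K) • ((∑ k, c k • P k) * (∑ k, c k • P k)) =
      (2 : K) • ((∑ k, c k ^ 2) • (1 : A)) := by
    calc
      _ = ∑ j, ∑ k, (c j * c k) • (P j * P k) + ∑ j, ∑ k, (c k * c j) • (P k * P j) := by
        rw [two_smul, expand, Finset.sum_comm (f := fun j k => (c k * c j) • (P k * P j))]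
      _ = ∑ j, ∑ k, if j = k then (2 * c j ^ 2) • (1 : A) else 0 := by
        simp only [← Finset.sum_add_distrib, diag]
      _ = _ := by
        simp [Finset.sum_smul, Finset.smul_sum, mul_smul]
  exact smul_right_injective A (NeZero.ne (2 : K)) double

/-- If `D` is traceless with `D ^ 2 = s ^ 2` and `s ≠ 0`, then the eigenspace of `D` at `s`
has half the full dimension. -/
theorem two_mul_finrank_ker_sub_of_mul_self {ι K : Type*} [Fintype ι] [DecidableEq ι] [Field K]
    [CharZero K] (D : Matrix ι ι K) {s : K} (hs : s ≠ 0)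
    (hD : D * D = (s ^ 2) • (1 : Matrix ι ι K)) (htr : D.trace = 0) :
    2 * Module.finrank K (LinearMap.ker (D - s • (1 : Matrix ι ι K)).mulVecLin) =
      Fintype.card ι := by
  have hproj : LinearMap.IsProj (LinearMap.ker (D - s • (1 : Matrix ι ι K)).mulVecLin)
      (Matrix.toLin' ((2⁻¹ : K) • (1 + s⁻¹ • D))) := by
    constructor
    · intro x
      have : (D - s • (1 : Matrix ι ι K)) * ((2⁻¹ : K) • (1 + s⁻¹ • D)) = 0 := by
        simp only [mul_smul_comm, mul_add, sub_mul, hD, smul_mul_assoc, one_mul, mul_one,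
          smul_sub, smul_add, smul_smul]
        rw [show 2⁻¹ * s⁻¹ * s ^ 2 = 2⁻¹ * s by field_simp,
          show 2⁻¹ * s⁻¹ * s = 2⁻¹ by field_simp]
        module
      rw [LinearMap.mem_ker, Matrix.mulVecLin_apply, Matrix.toLin'_apply, Matrix.mulVec_mulVec,
        this, Matrix.zero_mulVec]
    · intro x hx
      rw [LinearMap.mem_ker, Matrix.mulVecLin_apply, Matrix.sub_mulVec, Matrix.smul_mulVec,
        Matrix.one_mulVec, sub_eq_zero] at hx
      rw [Matrix.toLin'_apply, Matrix.smul_mulVec, Matrix.add_mulVec, Matrix.smul_mulVec,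
        Matrix.one_mulVec, hx, smul_smul, inv_mul_cancel₀ hs]
      module
  have htrace := hproj.trace
  rw [Matrix.trace_toLin'_eq, Matrix.trace_smul, Matrix.trace_add, Matrix.trace_smul, htr,
    Matrix.trace_one] at htrace
  have : (2 : K) * Module.finrank K (LinearMap.ker (D - s • (1 : Matrix ι ι K)).mulVecLin) =
      Fintype.card ι := by
    rw [← htrace]
    simp
  exact_mod_cast this

/-- For a nonzero real linear combination `D = ∑ c k • P k` of pairwise anticommuting
Hermitian traceless involutions on `n` qubits (matrices of size `2 ^ n`), each of the two
eigenspaces `ker (D ∓ ‖c‖₂ • 1)` has complex dimension `2 ^ (n - 1)`. -/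
theorem eigenspace_dim_of_anticommuting_combination {n m : ℕ} (hn : 1 ≤ n)
    (P : Fin m → Matrix (Fin (2 ^ n)) (Fin (2 ^ n)) ℂ)
    (hherm : ∀ k, (P k).IsHermitian)
    (hsq : ∀ k, P k * P k = 1)
    (htr : ∀ k, (P k).trace = 0)
    (hanti : ∀ j k, j ≠ k → P j * P k = -(P k * P j))
    (c : Fin m → ℝ) (hc : c ≠ 0) :
    Module.finrank ℂ
        ↥(LinearMap.ker ((∑ k, (c k : ℂ) • P k)
            - (Real.sqrt (∑ k, (c k) ^ 2) : ℂ) • (1 : Matrix (Fin (2 ^ n)) (Fin (2 ^ n)) ℂ)).mulVecLin)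
      = 2 ^ (n - 1) ∧
    Module.finrank ℂ
        ↥(LinearMap.ker ((∑ k, (c k : ℂ) • P k)
            + (Real.sqrt (∑ k, (c k) ^ 2) : ℂ) • (1 : Matrix (Fin (2 ^ n)) (Fin (2 ^ n)) ℂ)).mulVecLin)
      = 2 ^ (n - 1) := by
  have hpos : 0 < ∑ k, c k ^ 2 := by
    obtain ⟨k, hk⟩ := Function.ne_iff.mp hc
    exact Finset.sum_pos' (fun i _ => sq_nonneg _) ⟨k, Finset.mem_univ k, by
      have : c k ≠ 0 := hk
      positivity⟩
  have hs : (Real.sqrt (∑ k, c k ^ 2) : ℂ) ≠ 0 :=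
    Complex.ofReal_ne_zero.mpr (Real.sqrt_pos.mpr hpos).ne'
  have hs2 : (Real.sqrt (∑ k, c k ^ 2) : ℂ) ^ 2 = ∑ k, (c k : ℂ) ^ 2 := by
    rw [← Complex.ofReal_pow, Real.sq_sqrt hpos.le]
    push_cast
    rfl
  have hD := sum_smul_mul_self_of_anticommute P hsq hanti (fun k => (c k : ℂ))
  have htrD : (∑ k, (c k : ℂ) • P k).trace = 0 := by
    simp [Matrix.trace_sum, Matrix.trace_smul, htr]
  have hcard : Fintype.card (Fin (2 ^ n)) = 2 * 2 ^ (n - 1) := by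
    rw [Fintype.card_fin, ← pow_succ', Nat.sub_add_cancel hn]
  have hplus := two_mul_finrank_ker_sub_of_mul_self _ hs (hD.trans (by rw [hs2])) htrD
  have hminus := two_mul_finrank_ker_sub_of_mul_self _ (neg_ne_zero.mpr hs)
    (hD.trans (by rw [neg_sq, hs2])) htrD
  rw [neg_smul, sub_neg_eq_add] at hminus
  exact ⟨Nat.eq_of_mul_eq_mul_left two_pos (hplus.trans hcard),
    Nat.eq_of_mul_eq_mul_left two_pos (hminus.trans hcard)⟩
end

section
/- Let n be a natural number and let v₁, …, v_m be elements of V := (Fin n → ZMod 2) × (Fin n → ZMod 2) such that ω(v_i, v_j) = 1 for all i ≠ j. Then m ≤ 2n + 1. (The maximum size of a set of pairwise anticommuting Pauli operators on n qubits is 2n + 1.) -/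
open BigOperators

/-- The symplectic form on the symplectic (binary) representation of `n`-qubit Pauli
operators: two Pauli operators commute iff the form evaluates to `0` on their
representatives and anticommute iff it evaluates to `1`. -/
def sympForm {n : ℕ} (u v : (Fin n → ZMod 2) × (Fin n → ZMod 2)) : ZMod 2 :=
  ∑ i, (u.1 i * v.2 i + u.2 i * v.1 i)

lemma sympForm_self {n : ℕ} (u : (Fin n → ZMod 2) × (Fin n → ZMod 2)) : sympForm u u = 0 :=
  Finset.sum_eq_zero fun i _ => by rw [mul_comm (u.2 i), CharTwo.add_self_eq_zero]

lemma sympForm_sum_smul_left {n : ℕ} {ι : Type*} (s : Finset ι) (c : ι → ZMod 2)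
    (v : ι → (Fin n → ZMod 2) × (Fin n → ZMod 2)) (w : (Fin n → ZMod 2) × (Fin n → ZMod 2)) :
    sympForm (∑ j ∈ s, c j • v j) w = ∑ j ∈ s, c j * sympForm (v j) w := by
  simp only [sympForm, Prod.fst_sum, Prod.snd_sum, Finset.sum_apply, Prod.smul_fst, Prod.smul_snd,
    Pi.smul_apply, smul_eq_mul, Finset.sum_mul, Finset.mul_sum, ← Finset.sum_add_distrib]
  rw [Finset.sum_comm]
  exact Finset.sum_congr rfl fun _ _ => Finset.sum_congr rfl fun _ _ => by ring

/-- Pairwise anticommuting vectors become linearly independent after appending a coordinate `1`. -/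
lemma linearIndependent_prodMk_one_of_anticommuting {n : ℕ} {ι : Type*} [Fintype ι]
    (v : ι → (Fin n → ZMod 2) × (Fin n → ZMod 2))
    (hanti : ∀ i j, i ≠ j → sympForm (v i) (v j) = 1) :
    LinearIndependent (ZMod 2) fun i => (v i, (1 : ZMod 2)) := by
  classical
  rw [Fintype.linearIndependent_iff]
  intro c hc j
  have hv : ∑ i, c i • v i = 0 := by simpa [Prod.fst_sum] using congrArg Prod.fst hc
  have hone : ∑ i, c i = 0 := by simpa [Prod.snd_sum] using congrArg Prod.snd hc
  have hpair : ∑ i, c i * sympForm (v i) (v j) = 0 := by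
    rw [← sympForm_sum_smul_left, hv]
    simp [sympForm]
  rw [← Finset.add_sum_erase _ _ (Finset.mem_univ j), sympForm_self, mul_zero, zero_add,
    Finset.sum_congr rfl fun i hi => by rw [hanti i j (Finset.ne_of_mem_erase hi), mul_one]]
    at hpair
  rwa [← Finset.add_sum_erase _ _ (Finset.mem_univ j), hpair, add_zero] at hone

/-- The maximum size of a set of pairwise anticommuting Pauli operators on `n` qubits
is `2 n + 1`. -/
theorem pairwise_anticommuting_card_le {n m : ℕ}
    (v : Fin m → (Fin n → ZMod 2) × (Fin n → ZMod 2))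
    (hanti : ∀ i j, i ≠ j → sympForm (v i) (v j) = 1) :
    m ≤ 2 * n + 1 := by
  have h := (linearIndependent_prodMk_one_of_anticommuting v hanti).fintype_card_le_finrank
  simpa [two_mul] using h
end

section
/- Let n ≥ 0 and let P₁, …, P_m be complex 2^n × 2^n matrices with P_k² = I for every k and P_j P_k = −P_k P_j for all j ≠ k. Then m ≤ 2n + 1. (Operator form of the bound: at most 2n + 1 pairwise anticommuting involutions can act on an n-qubit Hilbert space.) -/
open Matrix BigOperators

/-- An involution that anticommutes with another involution has a fixed space of half dimension. -/
theorem finrank_eq_two_mul_finrank_fixed {V : Type*} [AddCommGroup V] [Module ℂ V]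
    [FiniteDimensional ℂ V] {A B : Module.End ℂ V} (hA : A * A = 1) (hB : B * B = 1)
    (hAB : A * B = -(B * A)) :
    Module.finrank ℂ V = 2 * Module.finrank ℂ (Module.End.eigenspace A 1) := by
  have hA' (x : V) : A (A x) = x := LinearMap.congr_fun hA x
  have hB' (x : V) : B (B x) = x := LinearMap.congr_fun hB x
  have hAB' (x : V) : A (B x) = -B (A x) := LinearMap.congr_fun hAB x
  set E := Module.End.eigenspace A 1
  have hE (x : V) : x ∈ E ↔ A x = x := by simp [E]
  let f : E × E →ₗ[ℂ] V := E.subtype.coprod (B ∘ₗ E.subtype)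
  have hf : Function.Bijective f := by
    constructor
    · rw [injective_iff_map_eq_zero]
      rintro ⟨⟨a, ha⟩, ⟨b, hb⟩⟩ hab
      rw [hE] at ha hb
      have hsum : a + B b = 0 := hab
      have hdiff : a - B b = 0 := by
        simpa [ha, hb, hAB', sub_eq_add_neg] using congrArg A hsum
      have ha0 : a = 0 := by
        have : (2 : ℂ) • a = 0 := by
          rw [two_smul]
          calc a + a = (a + B b) + (a - B b) := by abel
            _ = 0 := by rw [hsum, hdiff, add_zero]
        simpa using this
      have hb0 : b = 0 := by
        rw [ha0, zero_add] at hsum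
        rw [← hB' b, hsum, map_zero]
      simp [ha0, hb0]
    · intro v
      refine ⟨(⟨(2⁻¹ : ℂ) • (v + A v), ?_⟩, ⟨(2⁻¹ : ℂ) • B (v - A v), ?_⟩), ?_⟩
      · rw [hE, map_smul, map_add, hA', add_comm]
      · rw [hE, map_smul, hAB', map_sub, hA', ← map_neg, neg_sub]
      · change (2⁻¹ : ℂ) • (v + A v) + B ((2⁻¹ : ℂ) • B (v - A v)) = v
        rw [map_smul, hB']
        module
  rw [← (LinearEquiv.ofBijective f hf).finrank_eq, Module.finrank_prod, two_mul]

/-- At most `2 n + 1` pairwise anticommuting involutions act on a complex vector space of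
dimension `2 ^ n`. -/
theorem Module.End.pairwise_anticommuting_involutions_card_le {V : Type*} [AddCommGroup V]
    [Module ℂ V] [FiniteDimensional ℂ V] {n m : ℕ} (hV : Module.finrank ℂ V = 2 ^ n)
    (P : Fin m → Module.End ℂ V) (hsq : ∀ k, P k * P k = 1)
    (hanti : ∀ j k, j ≠ k → P j * P k = -(P k * P j)) : m ≤ 2 * n + 1 := by
  induction n generalizing V m with
  | zero =>
    by_contra! hm
    have h := finrank_eq_two_mul_finrank_fixed (hsq ⟨0, by omega⟩) (hsq ⟨1, by omega⟩)
      (hanti _ _ (by simp))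
    omega
  | succ n ih =>
    match m, P, hsq, hanti with
    | 0, _, _, _ => omega
    | 1, _, _, _ => omega
    | m + 2, P, hsq, hanti =>
      have hdim := finrank_eq_two_mul_finrank_fixed (hsq 0) (hsq 1) (hanti _ _ (by simp))
      set E := Module.End.eigenspace (P 0) 1
      have hE (x : V) : x ∈ E ↔ P 0 x = x := by simp [E]
      have hsq' (k) (x : V) : P k (P k x) = x := LinearMap.congr_fun (hsq k) x
      have hanti' (j k) (h : j ≠ k) (x : V) : P j (P k x) = -P k (P j x) :=
        LinearMap.congr_fun (hanti j k h) x
      have h0 (j : Fin m) : (0 : Fin (m + 2)) ≠ j.succ.succ := (Fin.succ_ne_zero _).symm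
      have h1 (j : Fin m) : (1 : Fin (m + 2)) ≠ j.succ.succ := by
        simp [Fin.ext_iff]
      let Q (j : Fin m) : Module.End ℂ V := Complex.I • (P 1 * P j.succ.succ)
      have hQ (j : Fin m) (x : V) : Q j x = Complex.I • P 1 (P j.succ.succ x) := rfl
      have hQQ (j k : Fin m) (x : V) : Q j (Q k x) = P j.succ.succ (P k.succ.succ x) := by
        rw [hQ, hQ, map_smul, map_smul, smul_smul, Complex.I_mul_I,
          hanti' _ _ (h1 j).symm, map_neg, hsq', neg_one_smul, neg_neg]
      have hQE (j : Fin m) (x : V) (hx : x ∈ E) : Q j x ∈ E := by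
        rw [hE] at hx ⊢
        rw [hQ, map_smul, hanti' 0 1 (by simp), hanti' _ _ (h0 j), map_neg, neg_neg, hx]
      have hle := ih (V := E) (by rw [pow_succ] at hV; omega)
        (fun j => (Q j).restrict (hQE j))
        (fun j => by
          ext x
          exact (hQQ j j x).trans (hsq' _ _))
        (fun j k hjk => by
          ext x
          change Q j (Q k x) = -Q k (Q j x)
          rw [hQQ, hQQ]
          exact hanti' _ _ (by simpa using hjk) _)
      omega

/-- At most `2 n + 1` pairwise anticommuting involutions can act on an `n`-qubit
Hilbert space: if `P₁, …, P_m` are complex `2 ^ n × 2 ^ n` matrices with `P k ^ 2 = 1`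
and `P j * P k = -(P k * P j)` for `j ≠ k`, then `m ≤ 2 n + 1`. -/
theorem pairwise_anticommuting_involutions_card_le {n m : ℕ}
    (P : Fin m → Matrix (Fin (2 ^ n)) (Fin (2 ^ n)) ℂ)
    (hsq : ∀ k, P k * P k = 1)
    (hanti : ∀ j k, j ≠ k → P j * P k = -(P k * P j)) :
    m ≤ 2 * n + 1 := by
  refine Module.End.pairwise_anticommuting_involutions_card_le
    (V := Fin (2 ^ n) → ℂ) (by simp) (fun k => Matrix.toLinAlgEquiv' (P k)) (fun k => ?_)
    (fun j k hjk => ?_)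
  · rw [← map_mul, hsq, map_one]
  · rw [← map_mul, ← map_mul, ← map_neg, hanti j k hjk]
end

section
/- Let n be a natural number, 1 ≤ M ≤ n, and let v₁, …, v_M be elements of V := (Fin n → ZMod 2) × (Fin n → ZMod 2) that are linearly independent over ZMod 2 and satisfy ω(v_i, v_j) = 0 for all i, j. Then there exists a ZMod 2-linear automorphism f of V with ω(f(u), f(w)) = ω(u, w) for all u, w ∈ V and f(v_i) = (0, e_i) for each i, where e_i ∈ (Fin n → ZMod 2) is the i-th standard basis vector. (In the symplectic representation of the Pauli group: an independent set of M ≤ n commuting Pauli operators generating a stabilizer group can be mapped by a Clifford operation onto single-qubit Z operators acting on distinct qubits.) -/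
open BigOperators

/-- The symplectic form as a bilinear form. -/
def sympBilin (n : ℕ) : LinearMap.BilinForm (ZMod 2) ((Fin n → ZMod 2) × (Fin n → ZMod 2)) :=
  LinearMap.mk₂ (ZMod 2) sympForm
    (fun u u' v => by
      simp only [sympForm, Prod.fst_add, Prod.snd_add, Pi.add_apply, ← Finset.sum_add_distrib]
      exact Finset.sum_congr rfl fun i _ => by ring)
    (fun c u v => by
      simp only [sympForm, Prod.smul_fst, Prod.smul_snd, Pi.smul_apply, smul_eq_mul,
        Finset.mul_sum]
      exact Finset.sum_congr rfl fun i _ => by ring)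
    (fun u v v' => by
      simp only [sympForm, Prod.fst_add, Prod.snd_add, Pi.add_apply, ← Finset.sum_add_distrib]
      exact Finset.sum_congr rfl fun i _ => by ring)
    (fun c u v => by
      simp only [sympForm, Prod.smul_fst, Prod.smul_snd, Pi.smul_apply, smul_eq_mul,
        Finset.mul_sum]
      exact Finset.sum_congr rfl fun i _ => by ring)

theorem sympBilin_apply {n : ℕ} (u v : (Fin n → ZMod 2) × (Fin n → ZMod 2)) :
    sympBilin n u v = ∑ i, (u.1 i * v.2 i + u.2 i * v.1 i) := rfl

theorem sympBilin_comm {n : ℕ} (u v : (Fin n → ZMod 2) × (Fin n → ZMod 2)) :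
    sympBilin n u v = sympBilin n v u := by
  simp only [sympBilin_apply]
  exact Finset.sum_congr rfl fun i _ => by ring

theorem sympBilin_self {n : ℕ} (u : (Fin n → ZMod 2) × (Fin n → ZMod 2)) :
    sympBilin n u u = 0 := by
  rw [sympBilin_apply]
  refine Finset.sum_eq_zero fun i _ => ?_
  rw [mul_comm (u.2 i), CharTwo.add_self_eq_zero]

/-- Every linear functional is represented by the symplectic form. -/
theorem exists_sympBilin_eq {n : ℕ}
    (φ : (Fin n → ZMod 2) × (Fin n → ZMod 2) →ₗ[ZMod 2] ZMod 2) :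
    ∃ w, sympBilin n w = φ := by
  refine ⟨(fun i => φ (0, Pi.single i 1), fun i => φ (Pi.single i 1, 0)), ?_⟩
  ext i <;> simp [sympBilin_apply, Pi.single_apply]

/-- For fewer than `n` vectors, some vector outside their span is orthogonal to all of them. -/
theorem exists_orthogonal_notMem_span {n M : ℕ} (hMn : M < n)
    (v : Fin M → (Fin n → ZMod 2) × (Fin n → ZMod 2)) :
    ∃ u, u ∉ Submodule.span (ZMod 2) (Set.range v) ∧ ∀ i, sympBilin n (v i) u = 0 := by
  let L := LinearMap.pi fun i => sympBilin n (v i)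
  by_contra! h
  have hle : L.ker ≤ Submodule.span (ZMod 2) (Set.range v) := by
    intro u hu
    by_contra hus
    obtain ⟨i, hi⟩ := h u hus
    exact hi (congrFun (LinearMap.mem_ker.mp hu) i)
  have h₁ := Submodule.finrank_mono hle
  have h₂ : Module.finrank (ZMod 2) (Submodule.span (ZMod 2) (Set.range v)) ≤ M := by
    simpa [Set.finrank] using finrank_range_le_card (R := ZMod 2) v
  have h₃ := L.finrank_range_add_finrank_ker
  have h₄ := L.range.finrank_le
  simp only [Module.finrank_prod, Module.finrank_fin_fun] at h₃ h₄
  omega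

/-- Every independent isotropic family extends to one with `n` members. -/
theorem exists_isotropic_extension {n M : ℕ} (hMn : M ≤ n)
    (v : Fin M → (Fin n → ZMod 2) × (Fin n → ZMod 2)) (hind : LinearIndependent (ZMod 2) v)
    (hiso : ∀ i j, sympBilin n (v i) (v j) = 0) :
    ∃ v' : Fin n → (Fin n → ZMod 2) × (Fin n → ZMod 2), LinearIndependent (ZMod 2) v' ∧
      (∀ i j, sympBilin n (v' i) (v' j) = 0) ∧ ∀ i, v' (Fin.castLE hMn i) = v i := by
  obtain ⟨k, hk⟩ := Nat.exists_eq_add_of_le hMn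
  induction k generalizing M with
  | zero =>
    obtain rfl : n = M := hk
    exact ⟨v, hind, hiso, fun i => rfl⟩
  | succ k ih =>
    obtain ⟨u, hu, huv⟩ := exists_orthogonal_notMem_span (by omega) v
    obtain ⟨v', h₁, h₂, h₃⟩ := ih (M := M + 1) (by omega) (Fin.snoc v u)
      (linearIndependent_finSnoc.mpr ⟨hind, hu⟩)
      (by
        intro i j
        induction i using Fin.lastCases <;> induction j using Fin.lastCases <;>
          simp [hiso, huv, sympBilin_self, sympBilin_comm u])
      (by omega)
    refine ⟨v', h₁, h₂, fun i => ?_⟩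
    simpa using h₃ i.castSucc

/-- An independent isotropic family has an isotropic symplectically dual family. -/
theorem exists_isotropic_dual {n M : ℕ}
    (v : Fin M → (Fin n → ZMod 2) × (Fin n → ZMod 2)) (hind : LinearIndependent (ZMod 2) v)
    (hiso : ∀ i j, sympBilin n (v i) (v j) = 0) :
    ∃ w : Fin M → (Fin n → ZMod 2) × (Fin n → ZMod 2),
      (∀ i j, sympBilin n (w i) (v j) = if i = j then 1 else 0) ∧
      ∀ i j, sympBilin n (w i) (w j) = 0 := by
  obtain ⟨g, hg⟩ := LinearMap.exists_leftInverse_of_injective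
    (Fintype.linearCombination (ZMod 2) v)
    (LinearMap.ker_eq_bot.mpr hind.fintypeLinearCombination_injective)
  have hgv (j : Fin M) : g (v j) = Pi.single j 1 := by
    simpa using LinearMap.congr_fun hg (Pi.single j 1)
  choose w hw using fun i => exists_sympBilin_eq (LinearMap.proj i ∘ₗ g)
  have hwv (i j : Fin M) : sympBilin n (w i) (v j) = if i = j then 1 else 0 := by
    simp [hw, hgv, Pi.single_apply]
  refine ⟨fun i => w i + ∑ j, (if j < i then sympBilin n (w i) (w j) else 0) • v j, ?_, ?_⟩
  · intro i j
    simp only [map_add, map_sum, map_smul, LinearMap.add_apply, LinearMap.sum_apply,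
      LinearMap.smul_apply, hiso, hwv, smul_zero, Finset.sum_const_zero, add_zero]
  · intro i j
    simp only [map_add, map_sum, map_smul, LinearMap.add_apply, LinearMap.sum_apply,
      LinearMap.smul_apply, hiso, hwv, sympBilin_comm (v _) (w _), smul_eq_mul, mul_ite, mul_one,
      mul_zero, Finset.sum_const_zero, add_zero, Finset.sum_ite_eq, Finset.mem_univ, if_true]
    rcases lt_trichotomy i j with h | rfl | h
    · simp [h, h.not_gt, sympBilin_comm (w j), CharTwo.add_self_eq_zero]
    · simp [sympBilin_self]
    · simp [h, h.not_gt, CharTwo.add_self_eq_zero]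

/-- An independent set of `M ≤ n` commuting Pauli operators (an isotropic, linearly
independent family in the symplectic representation) can be mapped by a Clifford
operation (a symplectic-form-preserving linear automorphism) onto the single-qubit
`Z` operators `(0, eᵢ)` on distinct qubits. -/
theorem stabilizer_generators_to_single_qubit_Z {n M : ℕ} (hM1 : 1 ≤ M) (hMn : M ≤ n)
    (v : Fin M → (Fin n → ZMod 2) × (Fin n → ZMod 2))
    (hind : LinearIndependent (ZMod 2) v)
    (hiso : ∀ i j, sympForm (v i) (v j) = 0) :
    ∃ f : ((Fin n → ZMod 2) × (Fin n → ZMod 2)) ≃ₗ[ZMod 2]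
        ((Fin n → ZMod 2) × (Fin n → ZMod 2)),
      (∀ u w, sympForm (f u) (f w) = sympForm u w) ∧
      ∀ i : Fin M, f (v i) = (0, Pi.single (Fin.castLE hMn i) 1) := by
  obtain ⟨v', hind', hiso', hv'⟩ := exists_isotropic_extension hMn v hind hiso
  obtain ⟨w, hwv, hww⟩ := exists_isotropic_dual v' hind' hiso'
  let g := (Fintype.linearCombination (ZMod 2) w).coprod (Fintype.linearCombination (ZMod 2) v')
  have hg (a b) : sympBilin n (g a) (g b) = sympBilin n a b := by
    simp [g, Fintype.linearCombination_apply, hww, hwv, hiso', sympBilin_comm (v' _) (w _),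
      sympBilin_apply a b, Finset.sum_add_distrib, mul_comm]
  have hinj : Function.Injective g := by
    rw [injective_iff_map_eq_zero]
    intro a ha
    have h (b) : sympBilin n a b = 0 := by rw [← hg, ha, map_zero, LinearMap.zero_apply]
    ext i
    · simpa [sympBilin_apply, Pi.single_apply] using h (0, Pi.single i 1)
    · simpa [sympBilin_apply, Pi.single_apply] using h (Pi.single i 1, 0)
  let e := LinearEquiv.ofInjectiveEndo g hinj
  refine ⟨e.symm, fun u w => ?_, fun i => ?_⟩
  · have h := hg (e.symm u) (e.symm w)
    rw [show g (e.symm u) = u from e.apply_symm_apply u,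
      show g (e.symm w) = w from e.apply_symm_apply w] at h
    exact h.symm
  · rw [LinearEquiv.symm_apply_eq]
    simp [e, g, hv']
end

section
/- Let n be a natural number, V := (Fin n → ZMod 2) × (Fin n → ZMod 2), and let W, A ⊆ V be finite sets such that: ω(w, w') = 0 for all w, w' ∈ W; ω(a, a') = 1 for all distinct a, a' ∈ A; and ω(w, a) = 0 for all w ∈ W, a ∈ A. Let S̄ be the closure under inference of W ∪ A, i.e., the smallest subset of V containing W ∪ A such that whenever u, v ∈ S̄ with ω(u, v) = 0, also u + v ∈ S̄. Then S̄ ⊆ span(W) ∪ ⋃_{a ∈ A} (a + span(W)), and consequently |S̄| ≤ 2^{|W|} · (1 + |A|). (The support of a noncontextual Pauli Hamiltonian generated by 𝒢 ∪ 𝒜 under the Jordan product has size at most 2^{|𝒢|}(1 + |𝒜|).) -/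
open BigOperators

lemma sympForm_comm {n : ℕ} (u v : (Fin n → ZMod 2) × (Fin n → ZMod 2)) :
    sympForm u v = sympForm v u :=
  Finset.sum_congr rfl fun _ _ => by ring

lemma sympForm_add_left {n : ℕ} (u v x : (Fin n → ZMod 2) × (Fin n → ZMod 2)) :
    sympForm (u + v) x = sympForm u x + sympForm v x := by
  simp only [sympForm, ← Finset.sum_add_distrib, Prod.fst_add, Prod.snd_add, Pi.add_apply]
  exact Finset.sum_congr rfl fun _ _ => by ring

lemma sympForm_add_right {n : ℕ} (x u v : (Fin n → ZMod 2) × (Fin n → ZMod 2)) :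
    sympForm x (u + v) = sympForm x u + sympForm x v := by
  simp only [sympForm_comm x, sympForm_add_left]

lemma sympForm_smul_left {n : ℕ} (c : ZMod 2) (u x : (Fin n → ZMod 2) × (Fin n → ZMod 2)) :
    sympForm (c • u) x = c * sympForm u x := by
  simp only [sympForm, Finset.mul_sum, Prod.smul_fst, Prod.smul_snd, Pi.smul_apply, smul_eq_mul]
  exact Finset.sum_congr rfl fun _ _ => by ring

/-- A vector orthogonal to a set is orthogonal to its span. -/
lemma sympForm_eq_zero_of_mem_span {n : ℕ} {W : Set ((Fin n → ZMod 2) × (Fin n → ZMod 2))}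
    {s x : (Fin n → ZMod 2) × (Fin n → ZMod 2)} (hx : ∀ w ∈ W, sympForm w x = 0)
    (hs : s ∈ Submodule.span (ZMod 2) W) : sympForm s x = 0 := by
  induction hs using Submodule.span_induction with
  | mem w hw => exact hx w hw
  | zero => simp [sympForm]
  | add u v _ _ hu hv => rw [sympForm_add_left, hu, hv, add_zero]
  | smul c u _ hu => rw [sympForm_smul_left, hu, mul_zero]

/-- The union of the span of a commuting set `W` with its cosets by a pairwise anticommuting
set commuting with `W` is closed under sums of commuting pairs. -/
lemma add_mem_span_union_cosets {n : ℕ} {W A : Set ((Fin n → ZMod 2) × (Fin n → ZMod 2))}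
    (hW : ∀ w ∈ W, ∀ w' ∈ W, sympForm w w' = 0)
    (hA : ∀ a ∈ A, ∀ a' ∈ A, a ≠ a' → sympForm a a' = 1)
    (hWA : ∀ w ∈ W, ∀ a ∈ A, sympForm w a = 0)
    {u v : (Fin n → ZMod 2) × (Fin n → ZMod 2)}
    (hu : u ∈ (↑(Submodule.span (ZMod 2) W) ∪
      ⋃ a ∈ A, (a + ·) '' (Submodule.span (ZMod 2) W : Set _)))
    (hv : v ∈ (↑(Submodule.span (ZMod 2) W) ∪
      ⋃ a ∈ A, (a + ·) '' (Submodule.span (ZMod 2) W : Set _)))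
    (huv : sympForm u v = 0) :
    u + v ∈ (↑(Submodule.span (ZMod 2) W) ∪
      ⋃ a ∈ A, (a + ·) '' (Submodule.span (ZMod 2) W : Set _)) := by
  simp only [Set.mem_union, Set.mem_iUnion, Set.mem_image, SetLike.mem_coe, exists_prop]
    at hu hv ⊢
  rcases hu with hu | ⟨a, ha, s, hs, rfl⟩ <;> rcases hv with hv | ⟨b, hb, t, ht, rfl⟩
  · exact Or.inl (add_mem hu hv)
  · exact Or.inr ⟨b, hb, u + t, add_mem hu ht, by abel⟩
  · exact Or.inr ⟨a, ha, s + v, add_mem hs hv, by abel⟩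
  · by_cases hab : a = b
    · subst hab
      refine Or.inl ?_
      have haa : a + a = 0 := by ext <;> exact CharTwo.add_self_eq_zero _
      rw [add_add_add_comm, haa, zero_add]
      exact add_mem hs ht
    · have hsb : sympForm s b = 0 := sympForm_eq_zero_of_mem_span (fun w hw => hWA w hw b hb) hs
      have hat : sympForm a t = 0 := by
        rw [sympForm_comm]
        exact sympForm_eq_zero_of_mem_span (fun w hw => hWA w hw a ha) ht
      have hst : sympForm s t = 0 := by
        refine sympForm_eq_zero_of_mem_span (fun w hw => ?_) hs
        rw [sympForm_comm]
        exact sympForm_eq_zero_of_mem_span (fun w' hw' => hW w' hw' w hw) ht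
      simp [sympForm_add_left, sympForm_add_right, hA a ha b hb hab, hsb, hat, hst] at huv

lemma ncard_span_finset_le {K M : Type*} [Field K] [Fintype K] [AddCommGroup M] [Module K M]
    (W : Finset M) :
    (Submodule.span K (W : Set M) : Set M).ncard ≤ Fintype.card K ^ W.card := by
  rw [← Nat.card_coe_set_eq, ← Nat.card_eq_fintype_card]
  refine (Module.natCard_eq_pow_finrank (K := K)
    (V := Submodule.span K (W : Set M))).trans_le ?_
  exact Nat.pow_le_pow_right Nat.card_pos (finrank_span_finset_le_card W)

/-- The closure under inference of `W ∪ A` (`W` a commuting set also commuting with the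
pairwise anticommuting set `A`), i.e. the smallest set containing `W ∪ A` closed under
sums of commuting pairs, is contained in `span W ∪ ⋃_{a ∈ A} (a + span W)`; consequently
its cardinality is at most `2 ^ |W| * (1 + |A|)`. -/
theorem closure_under_inference_bound {n : ℕ}
    (W A : Finset ((Fin n → ZMod 2) × (Fin n → ZMod 2)))
    (hW : ∀ w ∈ W, ∀ w' ∈ W, sympForm w w' = 0)
    (hA : ∀ a ∈ A, ∀ a' ∈ A, a ≠ a' → sympForm a a' = 1)
    (hWA : ∀ w ∈ W, ∀ a ∈ A, sympForm w a = 0)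
    (Sbar : Set ((Fin n → ZMod 2) × (Fin n → ZMod 2)))
    (hsub : ↑W ∪ ↑A ⊆ Sbar)
    (hclosed : ∀ u ∈ Sbar, ∀ v ∈ Sbar, sympForm u v = 0 → u + v ∈ Sbar)
    (hmin : ∀ T : Set ((Fin n → ZMod 2) × (Fin n → ZMod 2)), ↑W ∪ ↑A ⊆ T →
      (∀ u ∈ T, ∀ v ∈ T, sympForm u v = 0 → u + v ∈ T) → Sbar ⊆ T) :
    Sbar ⊆ (↑(Submodule.span (ZMod 2) (W : Set ((Fin n → ZMod 2) × (Fin n → ZMod 2)))) ∪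
        ⋃ a ∈ (A : Set ((Fin n → ZMod 2) × (Fin n → ZMod 2))),
          (a + ·) '' ↑(Submodule.span (ZMod 2) (W : Set ((Fin n → ZMod 2) × (Fin n → ZMod 2))))) ∧
    Sbar.ncard ≤ 2 ^ W.card * (1 + A.card) := by
  have hsubset := hmin _ ?_ fun u hu v hv huv => add_mem_span_union_cosets hW hA hWA hu hv huv
  · refine ⟨hsubset, ?_⟩
    have hspan := ncard_span_finset_le (K := ZMod 2) W
    rw [ZMod.card] at hspan
    refine (Set.ncard_le_ncard hsubset (Set.toFinite _)).trans <|
      (Set.ncard_union_le _ _).trans ?_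
    rw [mul_add, mul_one, mul_comm _ A.card]
    refine add_le_add hspan ((Finset.set_ncard_biUnion_le A _).trans ?_)
    exact Finset.sum_le_card_nsmul _ _ _ fun a _ =>
      (Set.ncard_image_le (Set.toFinite _)).trans hspan
  · refine Set.union_subset_union Submodule.subset_span fun a ha => ?_
    exact Set.mem_biUnion ha ⟨0, zero_mem _, add_zero a⟩
end

section
/- For every n ≥ 1 there exist vectors w₁, …, w_{n−1} ∈ V := (Fin n → ZMod 2) × (Fin n → ZMod 2), linearly independent over ZMod 2 with ω(w_i, w_j) = 0 for all i, j, and vectors a₁, a₂, a₃ ∈ V with ω(a_i, a_j) = 1 for all i ≠ j and ω(w_i, a_j) = 0 for all i, j, such that the set span{w₁,…,w_{n−1}} ∪ (a₁ + span{w₁,…,w_{n−1}}) ∪ (a₂ + span{w₁,…,w_{n−1}}) ∪ (a₃ + span{w₁,…,w_{n−1}}) has exactly 2^{n+1} elements. (The maximal support 2^{n+1} of a noncontextual Pauli Hamiltonian is attained, exceeding the maximum 2^n terms of a Hamiltonian of pairwise commuting Pauli operators.) -/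
open BigOperators

/-- The embedding of the `Z`-type Pauli operators on the last `m` qubits into the Pauli
operators on `m + 1` qubits. -/
def tailZ (m : ℕ) :
    (Fin m → ZMod 2) →ₗ[ZMod 2] (Fin (m + 1) → ZMod 2) × (Fin (m + 1) → ZMod 2) where
  toFun z := (0, Fin.cons 0 z)
  map_add' x y := by
    ext i
    · simp
    · refine Fin.cases ?_ (fun i => ?_) i <;> simp
  map_smul' c x := by
    ext i
    · simp
    · refine Fin.cases ?_ (fun i => ?_) i <;> simp

/-- The Pauli operator on `m + 1` qubits which is `(p, q)` on the first qubit and trivial on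
the others. -/
def headPauli (m : ℕ) (p q : ZMod 2) : (Fin (m + 1) → ZMod 2) × (Fin (m + 1) → ZMod 2) :=
  (Fin.cons p 0, Fin.cons q 0)

theorem tailZ_injective (m : ℕ) : Function.Injective (tailZ m) := fun _ _ h =>
  funext fun i => by simpa [tailZ] using congrFun (congrArg Prod.snd h) i.succ

theorem sympForm_tailZ_tailZ (m : ℕ) (y z : Fin m → ZMod 2) :
    sympForm (tailZ m y) (tailZ m z) = 0 := by
  simp [sympForm, tailZ]

theorem sympForm_tailZ_headPauli (m : ℕ) (z : Fin m → ZMod 2) (p q : ZMod 2) :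
    sympForm (tailZ m z) (headPauli m p q) = 0 := by
  simp [sympForm, tailZ, headPauli, Fin.sum_univ_succ]

theorem sympForm_headPauli_headPauli (m : ℕ) (p q p' q' : ZMod 2) :
    sympForm (headPauli m p q) (headPauli m p' q') = p * q' + q * p' := by
  simp [sympForm, headPauli, Fin.sum_univ_succ]

theorem linearIndependent_tailZ_single (m : ℕ) :
    LinearIndependent (ZMod 2) fun i : Fin m => tailZ m (Pi.single i 1) := by
  have h := (Pi.basisFun (ZMod 2) (Fin m)).linearIndependent.map' (tailZ m)
    (LinearMap.ker_eq_bot.2 (tailZ_injective m))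
  simpa [Function.comp_def] using h

theorem span_range_tailZ_single (m : ℕ) :
    Submodule.span (ZMod 2) (Set.range fun i => tailZ m (Pi.single i 1)) = (tailZ m).range := by
  have h := (Pi.basisFun (ZMod 2) (Fin m)).span_eq
  rw [LinearMap.range_eq_map, ← h, Submodule.map_span, ← Set.range_comp]
  congr 2
  ext1 i
  simp

/-- The first-qubit labels `X`, `Z` and `Y`, the three non-identity Pauli operators. -/
def anticommutingLabel : Fin 3 → ZMod 2 × ZMod 2 := ![(1, 0), (0, 1), (1, 1)]

theorem eq_zero_or_eq_anticommutingLabel :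
    ∀ c : ZMod 2 × ZMod 2, c = 0 ∨ ∃ j, c = anticommutingLabel j := by
  decide

theorem union_cosets_eq_range (m : ℕ) :
    (((tailZ m).range : Set ((Fin (m + 1) → ZMod 2) × (Fin (m + 1) → ZMod 2))) ∪
        ⋃ j : Fin 3, (headPauli m (anticommutingLabel j).1 (anticommutingLabel j).2 + ·) ''
          ((tailZ m).range : Set ((Fin (m + 1) → ZMod 2) × (Fin (m + 1) → ZMod 2)))) =
      Set.range fun x : (ZMod 2 × ZMod 2) × (Fin m → ZMod 2) =>
        headPauli m x.1.1 x.1.2 + tailZ m x.2 := by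
  have hzero : headPauli m 0 0 = 0 := by
    ext i <;> refine Fin.cases ?_ (fun i => ?_) i <;> simp [headPauli]
  ext v
  simp only [Set.mem_union, Set.mem_iUnion, Set.mem_image, SetLike.mem_coe, LinearMap.mem_range,
    Set.mem_range]
  constructor
  · rintro (⟨z, rfl⟩ | ⟨j, _, ⟨z, rfl⟩, rfl⟩)
    · exact ⟨(0, z), by simp [hzero]⟩
    · exact ⟨(anticommutingLabel j, z), rfl⟩
  · rintro ⟨⟨c, z⟩, rfl⟩
    rcases eq_zero_or_eq_anticommutingLabel c with rfl | ⟨j, rfl⟩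
    · exact Or.inl ⟨z, by simp [hzero]⟩
    · exact Or.inr ⟨j, _, ⟨z, rfl⟩, rfl⟩

theorem headPauli_add_tailZ_injective (m : ℕ) :
    Function.Injective fun x : (ZMod 2 × ZMod 2) × (Fin m → ZMod 2) =>
      headPauli m x.1.1 x.1.2 + tailZ m x.2 := by
  rintro ⟨⟨p, q⟩, y⟩ ⟨⟨p', q'⟩, z⟩ h
  have hp : p = p' := by
    simpa [headPauli, tailZ] using congrFun (congrArg Prod.fst h) 0
  have hq : q = q' := by
    simpa [headPauli, tailZ] using congrFun (congrArg Prod.snd h) 0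
  have hy : y = z := funext fun i => by
    simpa [headPauli, tailZ] using congrFun (congrArg Prod.snd h) i.succ
  rw [hp, hq, hy]

theorem ncard_union_cosets (m : ℕ) :
    (↑(Submodule.span (ZMod 2) (Set.range fun i => tailZ m (Pi.single i 1))) ∪
        ⋃ j : Fin 3, (headPauli m (anticommutingLabel j).1 (anticommutingLabel j).2 + ·) ''
          ↑(Submodule.span (ZMod 2) (Set.range fun i => tailZ m (Pi.single i 1)))).ncard =
      2 ^ (m + 1 + 1) := by
  rw [span_range_tailZ_single, union_cosets_eq_range, ← Set.image_univ,
    Set.ncard_image_of_injective _ (headPauli_add_tailZ_injective m), Set.ncard_univ]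
  simp only [Nat.card_eq_fintype_card, Fintype.card_prod, Fintype.card_fun, ZMod.card,
    Fintype.card_fin]
  ring

/-- The maximal support `2 ^ (n + 1)` of a noncontextual Pauli Hamiltonian on `n ≥ 1`
qubits is attained: there exist `n - 1` linearly independent pairwise commuting Pauli
operators `w i` and three pairwise anticommuting Pauli operators `a j` commuting with
every `w i` such that `span W ∪ (a₁ + span W) ∪ (a₂ + span W) ∪ (a₃ + span W)` has
exactly `2 ^ (n + 1)` elements. -/
theorem noncontextual_support_bound_attained (n : ℕ) (hn : 1 ≤ n) :
    ∃ (w : Fin (n - 1) → (Fin n → ZMod 2) × (Fin n → ZMod 2))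
      (a : Fin 3 → (Fin n → ZMod 2) × (Fin n → ZMod 2)),
      LinearIndependent (ZMod 2) w ∧
      (∀ i j, sympForm (w i) (w j) = 0) ∧
      (∀ i j, i ≠ j → sympForm (a i) (a j) = 1) ∧
      (∀ i j, sympForm (w i) (a j) = 0) ∧
      (↑(Submodule.span (ZMod 2) (Set.range w)) ∪
          ⋃ j : Fin 3, (a j + ·) '' ↑(Submodule.span (ZMod 2) (Set.range w))).ncard
        = 2 ^ (n + 1) := by
  obtain ⟨m, rfl⟩ : ∃ m, n = m + 1 := ⟨n - 1, by omega⟩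
  refine ⟨fun i : Fin m => tailZ m (Pi.single i 1),
    fun j => headPauli m (anticommutingLabel j).1 (anticommutingLabel j).2, ?_, ?_, ?_, ?_, ?_⟩
  · exact linearIndependent_tailZ_single m
  · exact fun i j => sympForm_tailZ_tailZ m _ _
  · intro i j
    rw [sympForm_headPauli_headPauli]
    revert i j
    decide
  · exact fun i j => sympForm_tailZ_headPauli m _ _ _
  · exact ncard_union_cosets m
end
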